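/- Let A be a unital ring that is an associative algebra over ℝ, let j : ℍ → A be a unital ℝ-algebra homomorphism, let T ∈ A, and let q ∈ ℍ be such that 𝒬_q(T) is invertible in A. Define the left S-resolvent S_L := −𝒬_q(T)⁻¹·(T − j(q̄)) and the right S-resolvent S_R := −(T − j(q̄))·𝒬_q(T)⁻¹. Then S_L·j(q) − T·S_L = 1 and j(q)·S_R − S_R·T = 1. -/

import Mathlib

/-- `𝒬_q(T) = T² − 2(Re q)•T + ‖q‖²•1` in an associative unital ℝ-algebra. -/
noncomputable def QopA {A : Type*} [Ring A] [Algebra ℝ A] (T : A) (q : Quaternion ℝ) : A :=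
  T ^ 2 - (2 * q.re) • T + (‖q‖ ^ 2) • (1 : A)

theorem map_add_map_star {A : Type*} [Ring A] [Algebra ℝ A]
    (j : Quaternion ℝ →ₐ[ℝ] A) (q : Quaternion ℝ) :
    j q + j (star q) = (2 * q.re) • (1 : A) := by
  rw [← map_add, Quaternion.self_add_star', ← Algebra.algebraMap_eq_smul_one, ← j.commutes]
  rfl

theorem map_mul_map_star {A : Type*} [Ring A] [Algebra ℝ A]
    (j : Quaternion ℝ →ₐ[ℝ] A) (q : Quaternion ℝ) :
    j q * j (star q) = (‖q‖ ^ 2) • (1 : A) := by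
  rw [← map_mul, Quaternion.self_mul_star, Quaternion.normSq_eq_norm_mul_self, ← pow_two,
    ← Algebra.algebraMap_eq_smul_one, ← j.commutes]
  rfl

theorem map_star_mul_map {A : Type*} [Ring A] [Algebra ℝ A]
    (j : Quaternion ℝ →ₐ[ℝ] A) (q : Quaternion ℝ) :
    j (star q) * j q = (‖q‖ ^ 2) • (1 : A) := by
  simpa using map_mul_map_star j (star q)

theorem commute_QopA {A : Type*} [Ring A] [Algebra ℝ A] (T : A) (q : Quaternion ℝ) :
    Commute T (QopA T q) :=
  (((Commute.refl T).pow_right 2).sub_right ((Commute.refl T).smul_right _)).add_right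
    ((Commute.one_right T).smul_right _)

theorem QopA_eq_left {A : Type*} [Ring A] [Algebra ℝ A]
    (j : Quaternion ℝ →ₐ[ℝ] A) (T : A) (q : Quaternion ℝ) :
    QopA T q = T * (T - j (star q)) - (T - j (star q)) * j q := by
  have h : (2 * q.re) • T = T * (j q + j (star q)) := by
    rw [map_add_map_star, mul_smul_comm, mul_one]
  rw [QopA, h, ← map_star_mul_map j q]
  noncomm_ring

theorem QopA_eq_right {A : Type*} [Ring A] [Algebra ℝ A]
    (j : Quaternion ℝ →ₐ[ℝ] A) (T : A) (q : Quaternion ℝ) :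
    QopA T q = (T - j (star q)) * T - j q * (T - j (star q)) := by
  have h : (2 * q.re) • T = (j q + j (star q)) * T := by
    rw [map_add_map_star, smul_mul_assoc, one_mul]
  rw [QopA, h, ← map_mul_map_star j q]
  noncomm_ring

theorem stmt13 {A : Type*} [Ring A] [Algebra ℝ A]
    (j : Quaternion ℝ →ₐ[ℝ] A) (T : A) (q : Quaternion ℝ)
    (u : Aˣ) (hu : (u : A) = QopA T q)
    (SL SR : A)
    (hSL : SL = -(((u⁻¹ : Aˣ) : A) * (T - j (star q))))
    (hSR : SR = -((T - j (star q)) * ((u⁻¹ : Aˣ) : A))) :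
    SL * j q - T * SL = 1 ∧ j q * SR - SR * T = 1 := by
  have hT : T * ((u⁻¹ : Aˣ) : A) = ((u⁻¹ : Aˣ) : A) * T :=
    (hu ▸ commute_QopA T q : Commute T (u : A)).units_inv_right
  subst hSL hSR
  constructor
  · calc
      _ = T * ((u⁻¹ : Aˣ) : A) * (T - j (star q))
          - ((u⁻¹ : Aˣ) : A) * ((T - j (star q)) * j q) := by noncomm_ring
      _ = ((u⁻¹ : Aˣ) : A) * (T * (T - j (star q)) - (T - j (star q)) * j q) := by
        rw [hT, mul_assoc, ← mul_sub ((u⁻¹ : Aˣ) : A)]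
      _ = 1 := by rw [← QopA_eq_left, ← hu, Units.inv_mul]
  · calc
      _ = (T - j (star q)) * (((u⁻¹ : Aˣ) : A) * T)
          - j q * (T - j (star q)) * ((u⁻¹ : Aˣ) : A) := by noncomm_ring
      _ = ((T - j (star q)) * T - j q * (T - j (star q))) * ((u⁻¹ : Aˣ) : A) := by
        rw [← hT, ← mul_assoc, sub_mul _ _ ((u⁻¹ : Aˣ) : A)]
      _ = 1 := by rw [← QopA_eq_right, ← hu, Units.mul_inv]
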